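/- arXiv:2411.10957 — 8 statements merged into one kernel-verified Lean document; each statement's English description precedes it below -/
import Mathlib

section
/- Let X and Y be real-valued random variables on a common probability space with |X| ≤ C and |Y| ≤ C almost surely (C > 0), E[X] = E[Y], Var(X) ≤ V and Var(Y) ≤ V (V > 0). Then E[|X − Y|] ≤ 3·(4CV)^{1/3}. -/
open MeasureTheory ProbabilityTheory

/-- For square-integrable random variables with equal means, the squared `L¹` distance is at most
twice the sum of the variances. -/
theorem sq_integral_abs_sub_le {Ω : Type*} [MeasurableSpace Ω] {P : Measure Ω}
    [IsProbabilityMeasure P] {X Y : Ω → ℝ} (hX : MemLp X 2 P) (hY : MemLp Y 2 P)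
    (hmean : ∫ ω, X ω ∂P = ∫ ω, Y ω ∂P) :
    (∫ ω, |X ω - Y ω| ∂P) ^ 2 ≤ 2 * (variance X P + variance Y P) := by
  have hXY : MemLp (fun ω => |X ω - Y ω|) 2 P := (hX.sub hY).abs
  have jensen : (∫ ω, |X ω - Y ω| ∂P) ^ 2 ≤ ∫ ω, |X ω - Y ω| ^ 2 ∂P := by
    have h := variance_nonneg (fun ω => |X ω - Y ω|) P
    rw [variance_eq_sub hXY] at h
    exact sub_nonneg.mp h
  have hXc : Integrable (fun ω => (X ω - ∫ ω, X ω ∂P) ^ 2) P :=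
    (hX.sub (memLp_const _)).integrable_sq
  have hYc : Integrable (fun ω => (Y ω - ∫ ω, Y ω ∂P) ^ 2) P :=
    (hY.sub (memLp_const _)).integrable_sq
  rw [variance_eq_integral hX.aemeasurable, variance_eq_integral hY.aemeasurable,
    ← integral_add hXc hYc, ← integral_const_mul]
  refine jensen.trans (integral_mono hXY.integrable_sq ((hXc.add hYc).const_mul 2) fun ω => ?_)
  simp only [sq_abs, ← hmean]
  nlinarith [sq_nonneg ((X ω - ∫ ω, X ω ∂P) + (Y ω - ∫ ω, X ω ∂P))]

/-- Quantitative core of Theorem 3: for a.s. bounded random variables with equal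
means and variance at most `V`, `E[|X − Y|] ≤ 3·(4CV)^{1/3}`. -/
theorem expectation_diff_bound {Ω : Type*} [MeasurableSpace Ω] (P : Measure Ω)
    [IsProbabilityMeasure P] (X Y : Ω → ℝ)
    (hXm : Measurable X) (hYm : Measurable Y)
    (C : ℝ) (hC : 0 < C)
    (hXb : ∀ᵐ ω ∂P, |X ω| ≤ C) (hYb : ∀ᵐ ω ∂P, |Y ω| ≤ C)
    (hmean : ∫ ω, X ω ∂P = ∫ ω, Y ω ∂P)
    (V : ℝ) (hV : 0 < V)
    (hvX : variance X P ≤ V) (hvY : variance Y P ≤ V) :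
    ∫ ω, |X ω - Y ω| ∂P ≤ 3 * (4 * C * V) ^ ((1 : ℝ) / 3) := by
  have hX : MemLp X 2 P := MemLp.of_bound hXm.aestronglyMeasurable C hXb
  have hY : MemLp Y 2 P := MemLp.of_bound hYm.aestronglyMeasurable C hYb
  have hsq := sq_integral_abs_sub_le hX hY hmean
  have hbound : ∫ ω, |X ω - Y ω| ∂P ≤ 2 * C := by
    have hle : ∀ᵐ ω ∂P, |X ω - Y ω| ≤ 2 * C := by
      filter_upwards [hXb, hYb] with ω hx hy
      linarith [abs_sub (X ω) (Y ω)]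
    simpa using integral_mono_ae ((hX.sub hY).abs.integrable one_le_two)
      (integrable_const (2 * C)) hle
  have hnonneg : 0 ≤ ∫ ω, |X ω - Y ω| ∂P := integral_nonneg fun ω => abs_nonneg _
  have hCV : 0 < C * V := mul_pos hC hV
  have hroot : ((4 * C * V) ^ ((1 : ℝ) / 3)) ^ 3 = 4 * C * V := by
    rw [← Real.rpow_natCast, ← Real.rpow_mul (by positivity)]
    norm_num
  refine le_of_pow_le_pow_left₀ three_ne_zero (by positivity) ?_
  calc (∫ ω, |X ω - Y ω| ∂P) ^ 3
      = (∫ ω, |X ω - Y ω| ∂P) * (∫ ω, |X ω - Y ω| ∂P) ^ 2 := by ring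
    _ ≤ (2 * C) * (4 * V) := by gcongr; linarith
    _ ≤ (3 * (4 * C * V) ^ ((1 : ℝ) / 3)) ^ 3 := by rw [mul_pow, hroot]; linarith
end

section
/- Let μ₁, …, μₙ be Borel probability measures on ℝ with finite first moments and cumulative distribution functions F₁, …, Fₙ, and suppose D ≥ 0 satisfies ∫_ℝ |Fᵢ(x) − Fⱼ(x)| dx ≤ D for all i, j. Let S > 0 and let η₁, …, ηₙ and ν₁, …, νₙ be real numbers with 0 < ηᵢ < S, 0 < νᵢ < S for all i and Σᵢ ηᵢ = Σᵢ νᵢ = S. Then ∫_ℝ |Σᵢ (ηᵢ − νᵢ) Fᵢ(x)| dx ≤ D · Σᵢ max(ηᵢ − νᵢ, 0), and moreover Σᵢ max(ηᵢ − νᵢ, 0) < S. -/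
open MeasureTheory
open scoped BigOperators

/-- The CDF of a probability measure with finite first moment differs from the CDF of the Dirac
mass at `0` by a Lebesgue integrable function. -/
theorem integrable_measureReal_Iic_sub_indicator (μ : Measure ℝ) [IsProbabilityMeasure μ]
    (hμ : Integrable (fun x => x) μ) :
    Integrable (fun x : ℝ => μ.real (Set.Iic x) - (Set.Ici (0 : ℝ)).indicator 1 x) := by
  let k : ℝ × ℝ → ℝ := fun p =>
    {p : ℝ × ℝ | p.1 ≤ p.2}.indicator 1 p - {p : ℝ × ℝ | 0 ≤ p.2}.indicator 1 p
  have hk : Measurable k :=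
    (measurable_one.indicator (measurableSet_le measurable_fst measurable_snd)).sub
      (measurable_one.indicator (measurableSet_le measurable_const measurable_snd))
  have hnorm (y x : ℝ) : ‖k (y, x)‖ = (Set.Ico (min 0 y) (max 0 y)).indicator 1 x := by
    simp only [k, Set.indicator_apply, Set.mem_ofPred_eq, Set.mem_Ico, Pi.one_apply,
      min_le_iff, lt_max_iff]
    by_cases h₁ : y ≤ x <;> by_cases h₂ : 0 ≤ x <;> simp [h₁, h₂]
  have hFint : Integrable k (μ.prod volume) := by
    rw [integrable_prod_iff hk.aestronglyMeasurable]
    constructor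
    · refine .of_forall fun y => ?_
      refine (integrable_norm_iff (f := fun x => k (y, x))
        (hk.comp measurable_prodMk_left).aestronglyMeasurable).1 ?_
      simp_rw [hnorm]
      exact (integrable_indicator_iff measurableSet_Ico).2
        (integrableOn_const (C := (1 : ℝ)) (by simp))
    · refine hμ.abs.congr (.of_forall fun y => ?_)
      simp_rw [hnorm]
      rw [integral_indicator_one measurableSet_Ico, Real.volume_real_Ico_of_le (by simp)]
      simp [max_sub_min_eq_abs']
  refine hFint.integral_prod_right.congr (.of_forall fun x => ?_)
  have h₁ (y : ℝ) : k (y, x) = (Set.Iic x).indicator 1 y - (Set.Ici (0 : ℝ)).indicator 1 x := by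
    simp [k, Set.indicator_apply]
  simp_rw [h₁]
  have h₂ : Integrable ((Set.Iic x).indicator (1 : ℝ → ℝ)) μ :=
    (integrable_const (1 : ℝ)).indicator measurableSet_Iic
  rw [integral_sub h₂ (integrable_const _), integral_indicator_one measurableSet_Iic]
  simp

/-- A linear combination, with coefficients summing to zero, of functions that are pairwise within
`D` in `L¹` has `L¹` norm at most `D` times the sum of the positive parts of the coefficients. -/
theorem integral_abs_sum_mul_le_of_sum_eq_zero {ι α : Type*} [Fintype ι] [MeasurableSpace α]
    {m : Measure α} {F : ι → α → ℝ} {D : ℝ}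
    (hFint : ∀ i j, Integrable (fun x => F i x - F j x) m)
    (hD : ∀ i j, ∫ x, |F i x - F j x| ∂m ≤ D) {a : ι → ℝ} (ha : ∑ i, a i = 0) :
    ∫ x, |∑ i, a i * F i x| ∂m ≤ D * ∑ i, max (a i) 0 := by
  set M := ∑ i, max (a i) 0 with hM
  have hsplit (i : ι) : a i = max (a i) 0 - max (-a i) 0 := by
    rcases le_total (a i) 0 with h | h <;> simp [h]
  have hneg : ∑ i, max (-a i) 0 = M := by
    have h : ∑ i, (max (a i) 0 - max (-a i) 0) = 0 := by simp_rw [← hsplit, ha]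
    rw [Finset.sum_sub_distrib] at h
    linarith
  have hM₀ : 0 ≤ M := Finset.sum_nonneg fun i _ => le_max_right _ _
  rcases hM₀.eq_or_lt with h₀ | hpos
  · have hzero (i : ι) : a i = 0 := by
      have hp := (Finset.sum_eq_zero_iff_of_nonneg (fun i _ => le_max_right (a i) 0)).1
        h₀.symm i (Finset.mem_univ i)
      have hq := (Finset.sum_eq_zero_iff_of_nonneg (fun i _ => le_max_right (-a i) 0)).1
        (hneg.trans h₀.symm) i (Finset.mem_univ i)
      rw [hsplit i, hp, hq, sub_zero]
    simp [hzero, ← h₀]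
  have hpair (x : α) : M * ∑ i, a i * F i x =
      ∑ i, ∑ j, max (a i) 0 * max (-a j) 0 * (F i x - F j x) := by
    have h₁ : ∑ i, ∑ j, max (a i) 0 * max (-a j) 0 * F i x = M * ∑ i, max (a i) 0 * F i x := by
      rw [Finset.mul_sum]
      refine Finset.sum_congr rfl fun i _ => ?_
      rw [← Finset.sum_mul, ← Finset.mul_sum, hneg]
      ring
    have h₂ : ∑ i, ∑ j, max (a i) 0 * max (-a j) 0 * F j x = M * ∑ j, max (-a j) 0 * F j x := by
      simp_rw [mul_assoc, ← Finset.mul_sum, ← Finset.sum_mul, ← hM]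
    simp_rw [mul_sub, Finset.sum_sub_distrib]
    rw [h₁, h₂, ← mul_sub, ← Finset.sum_sub_distrib]
    simp_rw [← sub_mul, ← hsplit]
  have hterm (i j : ι) :
      Integrable (fun x => max (a i) 0 * max (-a j) 0 * |F i x - F j x|) m :=
    (hFint i j).abs.const_mul _
  have hle : M * ∫ x, |∑ i, a i * F i x| ∂m ≤ M * (D * M) := calc
    M * ∫ x, |∑ i, a i * F i x| ∂m
      = ∫ x, |M * ∑ i, a i * F i x| ∂m := by
        simp_rw [abs_mul, abs_of_pos hpos, integral_const_mul]
    _ ≤ ∫ x, ∑ i, ∑ j, max (a i) 0 * max (-a j) 0 * |F i x - F j x| ∂m := by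
        refine integral_mono_of_nonneg (.of_forall fun x => abs_nonneg _)
          (integrable_finsetSum _ fun i _ => integrable_finsetSum _ fun j _ => hterm i j)
          (.of_forall fun x => ?_)
        simp only [hpair]
        refine (Finset.abs_sum_le_sum_abs _ _).trans (Finset.sum_le_sum fun i _ => ?_)
        refine (Finset.abs_sum_le_sum_abs _ _).trans (Finset.sum_le_sum fun j _ => ?_)
        rw [abs_mul, abs_of_nonneg (by positivity)]
    _ = ∑ i, ∑ j, max (a i) 0 * max (-a j) 0 * ∫ x, |F i x - F j x| ∂m := by
        rw [integral_finsetSum _ fun i _ => integrable_finsetSum _ fun j _ => hterm i j]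
        refine Finset.sum_congr rfl fun i _ => ?_
        rw [integral_finsetSum _ fun j _ => hterm i j]
        simp_rw [integral_const_mul]
    _ ≤ ∑ i, ∑ j, max (a i) 0 * max (-a j) 0 * D := by
        gcongr with i _ j _
        exact hD i j
    _ = M * (D * M) := by
        simp_rw [← Finset.sum_mul, ← Finset.mul_sum, hneg, ← Finset.sum_mul, ← hM]
        ring
  exact le_of_mul_le_mul_left hle hpos

/-- Lemma 3: bound on the `L¹` distance between two convex combinations (with
weight vectors `η`, `ν` summing to `S`) of CDFs `Fᵢ` of probability measures
`μᵢ` on `ℝ` that are pairwise within `D` in `L¹`. -/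
theorem mixture_cdf_bound (n : ℕ) (μ : Fin n → Measure ℝ)
    [∀ i, IsProbabilityMeasure (μ i)]
    (hmom : ∀ i, Integrable (fun x => x) (μ i))
    (F : Fin n → ℝ → ℝ) (hF : ∀ i x, F i x = ((μ i) (Set.Iic x)).toReal)
    (D : ℝ) (hD : 0 ≤ D)
    (hDbound : ∀ i j, ∫ x : ℝ, |F i x - F j x| ≤ D)
    (S : ℝ) (hS : 0 < S) (η ν : Fin n → ℝ)
    (hη : ∀ i, 0 < η i ∧ η i < S) (hν : ∀ i, 0 < ν i ∧ ν i < S)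
    (hηsum : ∑ i, η i = S) (hνsum : ∑ i, ν i = S) :
    (∫ x : ℝ, |∑ i, (η i - ν i) * F i x| ≤ D * ∑ i, max (η i - ν i) 0) ∧
      ∑ i, max (η i - ν i) 0 < S := by
  have hFint (i j : Fin n) : Integrable (fun x => F i x - F j x) := by
    refine ((integrable_measureReal_Iic_sub_indicator (μ i) (hmom i)).sub
      (integrable_measureReal_Iic_sub_indicator (μ j) (hmom j))).congr (.of_forall fun x => ?_)
    simp [hF, measureReal_def]
  refine ⟨integral_abs_sum_mul_le_of_sum_eq_zero hFint hDbound ?_, ?_⟩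
  · rw [Finset.sum_sub_distrib, hηsum, hνsum, sub_self]
  · have hne : (Finset.univ : Finset (Fin n)).Nonempty :=
      Finset.nonempty_of_sum_ne_zero (hηsum.trans_ne hS.ne')
    rw [← hηsum]
    exact Finset.sum_lt_sum_of_nonempty hne fun i _ =>
      max_lt (sub_lt_self _ (hν i).1) (hη i).1
end

section
/- Fix t_max ∈ ℤ and t ∈ ℤ with t ≤ t_max, and let g : ℕ → ℝ be nonnegative and summable. Then Σ_{t̃ ∈ T_single(t)} 2·g(|t̃ − t|) + Σ_{t̃ ∈ T_double(t)} g(|t̃ − t|) = 2 · Σ_{τ=0}^{∞} g(τ). -/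
/-- The times `s ≤ tmax` with `s = t` or `|s - t| > tmax - t` are exactly the times `t - n` with
`n = 0` or `n > tmax - t`. -/
theorem tsum_natAbs_single (tmax t : ℤ) (ht : t ≤ tmax) (f : ℕ → ℝ) :
    ∑' s : {s : ℤ // s ≤ tmax ∧ (s = t ∨ tmax - t < |s - t|)}, f ((s : ℤ) - t).natAbs =
      ∑' n : {n : ℕ | n = 0 ∨ tmax - t < n}, f n := by
  let e : {n : ℕ | n = 0 ∨ tmax - t < n} ≃
      {s : ℤ // s ≤ tmax ∧ (s = t ∨ tmax - t < |s - t|)} :=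
    { toFun := fun n => ⟨t - (n : ℕ), by obtain ⟨n, hn⟩ := n; simp at hn ⊢; omega⟩
      invFun := fun s => ⟨((s : ℤ) - t).natAbs, by
        obtain ⟨s, hs⟩ := s; simp only [Set.mem_ofPred_eq, Int.abs_eq_natAbs] at hs ⊢; omega⟩
      left_inv := fun n => Subtype.ext (by simp)
      right_inv := fun s => Subtype.ext (by
        obtain ⟨s, hs⟩ := s
        simp only [Int.abs_eq_natAbs] at hs ⊢
        omega) }
  rw [← e.tsum_eq]
  simp [e]

/-- Each time difference `0 < n ≤ tmax - t` is realised by exactly two times, `t - n` and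
`t + n`. -/
theorem tsum_natAbs_double (tmax t : ℤ) {f : ℕ → ℝ} (hf : Summable f) :
    ∑' s : {s : ℤ // s ≤ tmax ∧ 0 < |s - t| ∧ |s - t| ≤ tmax - t}, f ((s : ℤ) - t).natAbs =
      2 * ∑' n : ({n : ℕ | n = 0 ∨ tmax - t < n}ᶜ : Set ℕ), f n := by
  let S : Set ℕ := {n : ℕ | n = 0 ∨ tmax - t < n}ᶜ
  have hS (n : S) : 0 < (n : ℕ) ∧ ((n : ℕ) : ℤ) ≤ tmax - t := by
    obtain ⟨n, hn⟩ := n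
    simp only [S, Set.mem_compl_iff, Set.mem_ofPred_eq] at hn
    dsimp only
    omega
  let φ : S ⊕ S → {s : ℤ // s ≤ tmax ∧ 0 < |s - t| ∧ |s - t| ≤ tmax - t} :=
    Sum.elim (fun n => ⟨t - (n : ℕ), by have := hS n; simp only [Int.abs_eq_natAbs]; omega⟩)
      (fun n => ⟨t + (n : ℕ), by have := hS n; simp only [Int.abs_eq_natAbs]; omega⟩)
  have hφ : Function.Bijective φ := by
    constructor
    · rintro (a | a) (b | b) h <;> have ha := hS a <;> have hb := hS b <;>
        simp only [φ, Sum.elim_inl, Sum.elim_inr, Subtype.mk.injEq] at h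
      · exact congrArg Sum.inl (Subtype.ext (by omega))
      · omega
      · omega
      · exact congrArg Sum.inr (Subtype.ext (by omega))
    · rintro ⟨s, hs⟩
      have hmem : (s - t).natAbs ∈ S := by
        simp only [S, Set.mem_compl_iff, Set.mem_ofPred_eq]
        rw [Int.abs_eq_natAbs] at hs
        omega
      rcases le_total s t with h | h
      · exact ⟨Sum.inl ⟨_, hmem⟩, Subtype.ext (by simp only [φ, Sum.elim_inl]; omega)⟩
      · exact ⟨Sum.inr ⟨_, hmem⟩, Subtype.ext (by simp only [φ, Sum.elim_inr]; omega)⟩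
  have hfS : HasSum (fun n : S => f n) (∑' n : S, f n) := (hf.subtype S).hasSum
  rw [← (Equiv.ofBijective φ hφ).tsum_eq, two_mul]
  refine (HasSum.sum ?_ ?_).tsum_eq
  · simpa [φ, Function.comp_def] using hfS
  · simpa [φ, Function.comp_def] using hfS


/-- The combinatorial core of Theorem 1 (PMP): with the single-time set counted
twice and the double-time set once, each time difference `τ ≥ 0` receives total
weight `2·g(τ)`.  Here `tt` plays the role of the neighbor time `t̃`. -/
theorem pmp_weight_identity (tmax t : ℤ) (ht : t ≤ tmax)
    (g : ℕ → ℝ) (hg : ∀ n, 0 ≤ g n) (hsum : Summable g) :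
    (∑' tt : {tt : ℤ // tt ≤ tmax ∧ (tt = t ∨ tmax - t < |tt - t|)},
        2 * g ((tt : ℤ) - t).natAbs) +
      (∑' tt : {tt : ℤ // tt ≤ tmax ∧ 0 < |tt - t| ∧ |tt - t| ≤ tmax - t},
        g ((tt : ℤ) - t).natAbs) =
    2 * ∑' τ : ℕ, g τ := by
  rw [tsum_natAbs_single tmax t ht (fun n => 2 * g n), tsum_natAbs_double tmax t hsum, tsum_mul_left,
    ← mul_add, (hsum.subtype _).tsum_add_tsum_compl (hsum.subtype _)]
end

section
/- Let Y be a finite nonempty set, t_max ∈ ℤ, T = {t̃ ∈ ℤ : t̃ ≤ t_max}, and d ∈ ℕ. Let g : Y × Y × ℕ → ℝ be nonnegative with Σ_{τ≥0} g(y, ỹ, τ) summable for all y, ỹ and Σ_{ỹ∈Y} Σ_{τ≥0} g(y, ỹ, τ) > 0 for all y; let f : Y × T → ℝ be strictly positive; define the relative connectivity P_{y,t}(ỹ, t̃) = f(y, t)·g(y, ỹ, |t̃ − t|); and let μ : Y → ℝ^d. Then for every y ∈ Y and every t ∈ T, the PMP first moment (Σ_{ỹ∈Y} Σ_{t̃∈T}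 w_t(t̃)·P_{y,t}(ỹ, t̃)·μ(ỹ)) / (Σ_{ỹ∈Y} Σ_{t̃∈T} w_t(t̃)·P_{y,t}(ỹ, t̃)) equals (Σ_{ỹ∈Y} (Σ_{τ≥0} g(y, ỹ, τ))·μ(ỹ)) / (Σ_{ỹ∈Y} Σ_{τ≥0} g(y, ỹ, τ)); in particular it does not depend on t. -/
open scoped BigOperators

/-- Each distance `τ` carries total weight `2` in a half-line `{t̃ ≤ tmax}` when points at distance
in `[1, tmax - t]` from `t` have weight `1` and all others have weight `2`. -/
theorem hasSum_halfLine_weight_mul (tmax : ℤ) (t : {t : ℤ // t ≤ tmax}) {h : ℕ → ℝ}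
    (hh : Summable h) :
    HasSum (fun tt : {t : ℤ // t ≤ tmax} =>
      (if tt = t ∨ tmax - (t : ℤ) < |(tt : ℤ) - (t : ℤ)| then (2 : ℝ) else 1) *
        h ((tt : ℤ) - (t : ℤ)).natAbs) (2 * ∑' τ, h τ) := by
  obtain ⟨t, ht⟩ := t
  obtain ⟨m, rfl⟩ : ∃ m : ℕ, tmax = t + m := ⟨(tmax - t).toNat, by omega⟩
  let e : ℕ ≃ {s : ℤ // s ≤ t + m} :=
    { toFun := fun n => ⟨t + m - n, by omega⟩
      invFun := fun s => (t + m - s.1).toNat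
      left_inv := fun n => by simp
      right_inv := fun s => by
        have := s.2
        ext
        simp only
        omega }
  rw [← e.hasSum_iff, ← hasSum_nat_add_iff' m]
  have hhead : ∑ i ∈ Finset.range m, h (m - i) = ∑ k ∈ Finset.Icc 1 m, h k := by
    refine Finset.sum_bij' (fun i _ => m - i) (fun k _ => m - k) ?_ ?_ ?_ ?_ ?_ <;>
      simp only [Finset.mem_range, Finset.mem_Icc] <;> intros <;> first | omega | trivial
  have hfin : HasSum (fun k => if k ∈ Finset.Icc 1 m then h k else 0)
      (∑ k ∈ Finset.Icc 1 m, h k) := by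
    have := hasSum_sum_of_ne_finset_zero (f := fun k => if k ∈ Finset.Icc 1 m then h k else 0)
      (s := Finset.Icc 1 m) (L := .unconditional ℕ) (fun k hk => if_neg hk)
    rwa [Finset.sum_congr rfl fun k hk => if_pos hk] at this
  convert (hh.hasSum.mul_left 2).sub hfin using 1
  · funext k
    have habs : (t + m - ((k + m : ℕ) : ℤ) - t).natAbs = k := by omega
    have hiff : (t + m - ((k + m : ℕ) : ℤ) = t ∨
        t + m - t < |t + m - ((k + m : ℕ) : ℤ) - t|) ↔ k ∉ Finset.Icc 1 m := by
      rw [Finset.mem_Icc, Int.abs_eq_natAbs, habs]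
      omega
    simp only [Function.comp_apply, e, Equiv.coe_fn_mk, Subtype.mk.injEq, habs, hiff]
    by_cases hk : k ∈ Finset.Icc 1 m
    · simp only [hk, not_true_eq_false, if_true, if_false]
      ring
    · simp only [hk, not_false_eq_true, if_true, if_false]
      ring
  · rw [← hhead]
    congr 1
    refine Finset.sum_congr rfl fun i hi => ?_
    have hi := Finset.mem_range.mp hi
    have habs : (t + m - (i : ℤ) - t).natAbs = m - i := by omega
    have hiff : ¬ (t + m - (i : ℤ) = t ∨ t + m - t < |t + m - (i : ℤ) - t|) := by
      rw [Int.abs_eq_natAbs, habs]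
      omega
    simp only [Function.comp_apply, e, Equiv.coe_fn_mk, Subtype.mk.injEq, habs, if_neg hiff,
      one_mul]

/-- Theorem 1 (PMP): under the separability assumption
`P_{y,t}(ỹ, t̃) = f(y,t)·g(y,ỹ,|t̃−t|)`, the first moment of the message
aggregated by Persistent Message Passing equals
`(Σ_ỹ (Σ_τ g(y,ỹ,τ))·μ(ỹ)) / (Σ_ỹ Σ_τ g(y,ỹ,τ))`, independently of the target
node's time `t`.  Here `tt` plays the role of `t̃`, `yy` of `ỹ`, and the PMP
weight is `w t tt = 2` on `T_single(t)` and `1` on `T_double(t)`. -/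
theorem pmp_first_moment_invariant (Y : Type*) [Fintype Y] [Nonempty Y]
    (tmax : ℤ) (d : ℕ)
    (g : Y → Y → ℕ → ℝ) (hg0 : ∀ y yy n, 0 ≤ g y yy n)
    (hgsum : ∀ y yy, Summable (g y yy))
    (hgpos : ∀ y, 0 < ∑ yy : Y, ∑' τ : ℕ, g y yy τ)
    (f : Y → {t : ℤ // t ≤ tmax} → ℝ) (hf : ∀ y t, 0 < f y t)
    (P : Y → {t : ℤ // t ≤ tmax} → Y → {t : ℤ // t ≤ tmax} → ℝ)
    (hP : ∀ y t yy tt, P y t yy tt = f y t * g y yy ((tt : ℤ) - (t : ℤ)).natAbs)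
    (w : {t : ℤ // t ≤ tmax} → {t : ℤ // t ≤ tmax} → ℝ)
    (hw : ∀ t tt, w t tt =
      if tt = t ∨ tmax - (t : ℤ) < |(tt : ℤ) - (t : ℤ)| then 2 else 1)
    (μ : Y → Fin d → ℝ) :
    ∀ (y : Y) (t : {t : ℤ // t ≤ tmax}),
      (∑ yy : Y, ∑' tt : {t : ℤ // t ≤ tmax}, w t tt * P y t yy tt)⁻¹ •
          (∑ yy : Y, ∑' tt : {t : ℤ // t ≤ tmax}, (w t tt * P y t yy tt) • μ yy)
        = (∑ yy : Y, ∑' τ : ℕ, g y yy τ)⁻¹ •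
          (∑ yy : Y, (∑' τ : ℕ, g y yy τ) • μ yy) := by
  intro y t
  have key : ∀ yy, HasSum (fun tt => w t tt * P y t yy tt)
      (2 * f y t * ∑' τ, g y yy τ) := fun yy => by
    have h := (hasSum_halfLine_weight_mul tmax t (hgsum y yy)).mul_left (f y t)
    rw [← mul_assoc, mul_comm (f y t) 2] at h
    simpa only [hw, hP, mul_left_comm] using h
  have hc : 2 * f y t ≠ 0 := mul_ne_zero two_ne_zero (hf y t).ne'
  simp only [fun yy => (key yy).tsum_eq, fun yy => ((key yy).smul_const (μ yy)).tsum_eq,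
    ← Finset.mul_sum, mul_smul (2 * f y t), ← Finset.smul_sum]
  rw [smul_smul, mul_inv_rev, inv_mul_cancel_right₀ hc]
end

section
/- Let Y be a finite nonempty set, t_max ∈ ℤ, T = {t̃ ∈ ℤ : t̃ ≤ t_max}, and d ∈ ℕ. Let g : Y × Y × ℕ → ℝ be nonnegative with Σ_{τ≥0} g(y, ỹ, τ) summable for all y, ỹ and Σ_{ỹ∈Y} Σ_{τ≥0} g(y, ỹ, τ) > 0 for all y; let f : Y × T → ℝ be strictly positive; define the relative connectivity P_{y,t}(ỹ, t̃) = f(y, t)·g(y, ỹ, |t̃ − t|); and let μ : Y → ℝ^d. Then for every y ∈ Y and every t ∈ T, the MMP first moment (Σ_{ỹ∈Y} Σ_{t̃∈T, t̃ ≤ t} P_{y,t}(ỹ, t̃)·μ(ỹ)) / (Σ_{ỹ∈Y} Σ_{t̃∈T, t̃ ≤ t} P_{y,t}(ỹ, t̃)) equals (Σ_{ỹ∈Y} (Σ_{τ≥0} g(y, ỹ, τ))·μ(ỹ)) / (Σ_{ỹ∈Y} Σ_{τ≥0} g(y, ỹ, τ)); in particular it does not depend on t. -/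
open scoped BigOperators

/-- The times `s ≤ tmax` that do not exceed `t` are indexed by their delay `t - s`. -/
def delayEquiv {tmax : ℤ} (t : {s : ℤ // s ≤ tmax}) :
    ℕ ≃ {tt : {s : ℤ // s ≤ tmax} // (tt : ℤ) ≤ (t : ℤ)} where
  toFun n := ⟨⟨(t : ℤ) - n, by have := t.2; lia⟩, by simp⟩
  invFun tt := ((tt.1 : ℤ) - (t : ℤ)).natAbs
  left_inv n := by simp
  right_inv tt := by
    have := tt.2
    ext
    simp only
    lia

theorem tsum_past_natAbs {E : Type*} [AddCommMonoid E] [TopologicalSpace E] {tmax : ℤ}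
    (t : {s : ℤ // s ≤ tmax}) (h : ℕ → E) :
    ∑' tt : {tt : {s : ℤ // s ≤ tmax} // (tt : ℤ) ≤ (t : ℤ)},
      h ((tt.1 : ℤ) - (t : ℤ)).natAbs = ∑' τ : ℕ, h τ :=
  (delayEquiv t).symm.tsum_eq h

/-- Theorem 2 (MMP): under the separability assumption
`P_{y,t}(ỹ, t̃) = f(y,t)·g(y,ỹ,|t̃−t|)`, the first moment of the message
aggregated by Mono-directional Message Passing (which only aggregates over
neighbor times `t̃ ≤ t`) equals
`(Σ_ỹ (Σ_τ g(y,ỹ,τ))·μ(ỹ)) / (Σ_ỹ Σ_τ g(y,ỹ,τ))`, independently of the target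
node's time `t`.  Here `tt` plays the role of `t̃` and `yy` of `ỹ`. -/
theorem mmp_first_moment_invariant (Y : Type*) [Fintype Y] [Nonempty Y]
    (tmax : ℤ) (d : ℕ)
    (g : Y → Y → ℕ → ℝ) (hg0 : ∀ y yy n, 0 ≤ g y yy n)
    (hgsum : ∀ y yy, Summable (g y yy))
    (hgpos : ∀ y, 0 < ∑ yy : Y, ∑' τ : ℕ, g y yy τ)
    (f : Y → {t : ℤ // t ≤ tmax} → ℝ) (hf : ∀ y t, 0 < f y t)
    (P : Y → {t : ℤ // t ≤ tmax} → Y → {t : ℤ // t ≤ tmax} → ℝ)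
    (hP : ∀ y t yy tt, P y t yy tt = f y t * g y yy ((tt : ℤ) - (t : ℤ)).natAbs)
    (μ : Y → Fin d → ℝ) :
    ∀ (y : Y) (t : {t : ℤ // t ≤ tmax}),
      (∑ yy : Y, ∑' tt : {tt : {s : ℤ // s ≤ tmax} // (tt : ℤ) ≤ (t : ℤ)},
          P y t yy tt.1)⁻¹ •
          (∑ yy : Y, ∑' tt : {tt : {s : ℤ // s ≤ tmax} // (tt : ℤ) ≤ (t : ℤ)},
            (P y t yy tt.1) • μ yy)
        = (∑ yy : Y, ∑' τ : ℕ, g y yy τ)⁻¹ •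
          (∑ yy : Y, (∑' τ : ℕ, g y yy τ) • μ yy) := by
  intro y t
  have hden (yy : Y) : ∑' tt : {tt : {s : ℤ // s ≤ tmax} // (tt : ℤ) ≤ (t : ℤ)},
      P y t yy tt.1 = f y t * ∑' τ : ℕ, g y yy τ := by
    simp only [hP]
    rw [tsum_past_natAbs t (fun n => f y t * g y yy n), tsum_mul_left]
  have hnum (yy : Y) : ∑' tt : {tt : {s : ℤ // s ≤ tmax} // (tt : ℤ) ≤ (t : ℤ)},
      P y t yy tt.1 • μ yy = f y t • (∑' τ : ℕ, g y yy τ) • μ yy := by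
    simp only [hP]
    rw [tsum_past_natAbs t (fun n => (f y t * g y yy n) • μ yy),
      ((hgsum y yy).mul_left (f y t)).tsum_smul_const, tsum_mul_left, mul_smul]
  simp only [hden, hnum]
  rw [← Finset.mul_sum, ← Finset.smul_sum, smul_smul, mul_inv_rev,
    inv_mul_cancel_right₀ (hf y t).ne']
end

section
/- Let Y be a finite nonempty set, t_max ∈ ℤ, T = {t̃ ∈ ℤ : t̃ ≤ t_max}. Let g : Y × Y × ℕ → ℝ be nonnegative with Σ_{τ≥0} g(y, ỹ, τ) summable for all y, ỹ and Σ_{y'∈Y} Σ_{τ≥0} g(y, y', τ) > 0 for all y. For y ∈ Y, t ∈ T define the effective PMP weights λ_{y,t}(ỹ, t̃) = w_t(t̃)·g(y, ỹ, |t̃ − t|) / (2·Σ_{y'∈Y} Σ_{τ≥0} g(y, y', τ)). Then (i) for all y, ỹ ∈ Y and all t ∈ T, Σ_{t̃∈T} λ_{y,t}(ỹ, t̃) = (Σ_{τ≥0} g(y, ỹ, τ)) / (Σ_{y'∈Y} Σ_{τ≥0} g(y, y', τ)), which does not depend on t; and (ii) Σ_{ỹ∈Y} Σ_{t̃∈T}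 λ_{y,t}(ỹ, t̃) = 1. -/
open scoped BigOperators

/-- A section `a` of a map `d` transports a sum over the base to a sum supported on its range. -/
lemma hasSum_ite_section {α β : Type*} [DecidableEq α] {d : α → β} {a : β → α}
    (had : Function.LeftInverse d a) {f : β → ℝ} {S : ℝ} (hf : HasSum f S) :
    HasSum (fun x => if a (d x) = x then f (d x) else 0) S := by
  refine (had.injective.hasSum_iff ?_).1 ?_
  · intro x hx
    exact if_neg fun h => hx ⟨d x, h⟩
  · convert hf using 1
    funext n
    simp [had n]

/-- Summing a function of the distance to `t` with the weights `2` (unpaired times) and `1`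
(paired times) over all times up to `tmax` gives twice the sum over distances. -/
lemma hasSum_weighted_natAbs (tmax : ℤ) (t : {t : ℤ // t ≤ tmax}) {f : ℕ → ℝ} {S : ℝ}
    (hf : HasSum f S) :
    HasSum (fun s : {t : ℤ // t ≤ tmax} =>
      (if s = t ∨ tmax - (t : ℤ) < |(s : ℤ) - (t : ℤ)| then (2 : ℝ) else 1) *
        f ((s : ℤ) - (t : ℤ)).natAbs) (2 * S) := by
  obtain ⟨t, ht⟩ := t
  let d : {t : ℤ // t ≤ tmax} → ℕ := fun s => ((s : ℤ) - t).natAbs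
  let past : ℕ → {t : ℤ // t ≤ tmax} := fun n => ⟨t - n, by omega⟩
  let future : ℕ → {t : ℤ // t ≤ tmax} := fun n =>
    ⟨if (n : ℤ) ≤ tmax - t then t + n else t - n, by split_ifs <;> omega⟩
  have hpast : Function.LeftInverse d past := fun n => by
    simp only [d, past]; omega
  have hfuture : Function.LeftInverse d future := fun n => by
    simp only [d, future]; split_ifs <;> omega
  convert (hasSum_ite_section hpast hf).add (hasSum_ite_section hfuture hf) using 1
  · funext ⟨s, hs⟩
    have habs := Int.abs_eq_natAbs (s - t)
    have hp : past (d ⟨s, hs⟩) = ⟨s, hs⟩ ↔ s ≤ t := by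
      simp only [d, past, Subtype.mk.injEq]; omega
    have hq : future (d ⟨s, hs⟩) = ⟨s, hs⟩ ↔ t ≤ s ∨ tmax - t < |s - t| := by
      simp only [d, future, Subtype.mk.injEq]; split_ifs <;> omega
    simp only [hp, hq, Subtype.mk.injEq, d]
    split_ifs <;> first | omega | ring
  · ring

/-- The marginal-sum identity for the effective PMP weights
`λ_{y,t}(ỹ,t̃) = w_t(t̃)·g(y,ỹ,|t̃−t|) / (2·Σ_{y'} Σ_τ g(y,y',τ))`:
(i) their sum over `t̃` is `(Σ_τ g(y,ỹ,τ)) / (Σ_{y'} Σ_τ g(y,y',τ))`,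
independently of `t`; and (ii) they sum to 1 over `(ỹ, t̃)`.
Here `tt` plays the role of `t̃` and `yy` of `ỹ`. -/
theorem pmp_effective_weights (Y : Type*) [Fintype Y] [Nonempty Y] (tmax : ℤ)
    (g : Y → Y → ℕ → ℝ) (hg0 : ∀ y yy n, 0 ≤ g y yy n)
    (hgsum : ∀ y yy, Summable (g y yy))
    (hgpos : ∀ y, 0 < ∑ y' : Y, ∑' τ : ℕ, g y y' τ)
    (w : {t : ℤ // t ≤ tmax} → {t : ℤ // t ≤ tmax} → ℝ)
    (hw : ∀ t tt, w t tt =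
      if tt = t ∨ tmax - (t : ℤ) < |(tt : ℤ) - (t : ℤ)| then 2 else 1)
    (lam : Y → {t : ℤ // t ≤ tmax} → Y → {t : ℤ // t ≤ tmax} → ℝ)
    (hlam : ∀ y t yy tt, lam y t yy tt =
      w t tt * g y yy ((tt : ℤ) - (t : ℤ)).natAbs /
        (2 * ∑ y' : Y, ∑' τ : ℕ, g y y' τ)) :
    (∀ (y yy : Y) (t : {t : ℤ // t ≤ tmax}),
        ∑' tt : {t : ℤ // t ≤ tmax}, lam y t yy tt =
          (∑' τ : ℕ, g y yy τ) / (∑ y' : Y, ∑' τ : ℕ, g y y' τ)) ∧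
      (∀ (y : Y) (t : {t : ℤ // t ≤ tmax}),
        ∑ yy : Y, ∑' tt : {t : ℤ // t ≤ tmax}, lam y t yy tt = 1) := by
  have key : ∀ (y yy : Y) (t : {t : ℤ // t ≤ tmax}),
      ∑' tt : {t : ℤ // t ≤ tmax}, lam y t yy tt =
        (∑' τ : ℕ, g y yy τ) / (∑ y' : Y, ∑' τ : ℕ, g y y' τ) := by
    intro y yy t
    simp only [hlam, hw]
    rw [((hasSum_weighted_natAbs tmax t (hgsum y yy).hasSum).div_const _).tsum_eq]
    exact mul_div_mul_left _ _ two_ne_zero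
  refine ⟨key, fun y t => ?_⟩
  simp only [key]
  rw [← Finset.sum_div, div_self (hgpos y).ne']
end

section
/- Let Y be a finite nonempty set and T a countable index set. For each ỹ ∈ Y and t̃ ∈ T let μ_{ỹ,t̃} be a Borel probability measure on ℝ with finite first moment and cumulative distribution function F_{ỹ,t̃}, and suppose D ≥ 0 satisfies ∫_ℝ |F_{ỹ,t̃}(x) − F_{ỹ,t̃'}(x)| dx ≤ D for every ỹ ∈ Y and every t̃, t̃' ∈ T. Let λ, λ' : Y × T → ℝ be nonnegative summable weight families such that for each ỹ ∈ Y, Σ_{t̃∈T} λ(ỹ, t̃) = Σ_{t̃∈T} λ'(ỹ, t̃) = ρ(ỹ), with Σ_{ỹ∈Y} ρ(ỹ) = 1. Then ∫_ℝ |Σ_{ỹ∈Y} Σ_{t̃∈T} (λ(ỹ, t̃) − λ'(ỹ, t̃))·F_{ỹ,t̃}(x)| dx ≤ D. -/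
open MeasureTheory
open scoped BigOperators

/-- The distribution function of a probability measure with finite first moment differs from
that of the Dirac mass at `0` by an integrable function. -/
lemma integrable_cdf_sub_indicator (μ : Measure ℝ) [IsProbabilityMeasure μ]
    (hmom : Integrable (fun x => x) μ) :
    Integrable (fun x : ℝ => (μ (Set.Iic x)).toReal - (Set.Ici (0 : ℝ)).indicator 1 x) := by
  have hmeas : Measurable (fun x : ℝ => (μ (Set.Iic x)).toReal) := by
    refine Monotone.measurable fun a b hab => ?_
    exact ENNReal.toReal_mono (measure_ne_top _ _) (measure_mono (Set.Iic_subset_Iic.2 hab))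
  refine ⟨(hmeas.sub (measurable_one.indicator measurableSet_Ici)).aestronglyMeasurable, ?_⟩
  have hS : MeasurableSet {p : ℝ × ℝ | p.1 ∈ Set.uIcc 0 p.2} := by
    have : {p : ℝ × ℝ | p.1 ∈ Set.uIcc 0 p.2}
        = {p : ℝ × ℝ | min 0 p.2 ≤ p.1} ∩ {p : ℝ × ℝ | p.1 ≤ max 0 p.2} := by
      ext p; simp [Set.uIcc, Set.mem_Icc]
    rw [this]
    exact (measurableSet_le (by fun_prop) (by fun_prop)).inter
      (measurableSet_le (by fun_prop) (by fun_prop))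
  have hpt : ∀ x : ℝ, ‖(μ (Set.Iic x)).toReal - (Set.Ici (0 : ℝ)).indicator 1 x‖ₑ
      ≤ μ {z | x ∈ Set.uIcc 0 z} := by
    intro x
    by_cases hx : 0 ≤ x
    · have h1 : (μ (Set.Iic x)).toReal - (Set.Ici (0 : ℝ)).indicator 1 x
          = -(μ (Set.Ioi x)).toReal := by
        have h := probReal_compl_eq_one_sub (μ := μ) (measurableSet_Iic (a := x))
        rw [Set.compl_Iic] at h
        simp only [Measure.real] at h
        rw [h]
        simp [hx]
      rw [h1, enorm_neg, Real.enorm_of_nonneg ENNReal.toReal_nonneg,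
        ENNReal.ofReal_toReal (measure_ne_top _ _)]
      refine measure_mono fun z hz => ?_
      exact Set.mem_uIcc.2 (Or.inl ⟨hx, (Set.mem_Ioi.1 hz).le⟩)
    · have h1 : (Set.Ici (0 : ℝ)).indicator (1 : ℝ → ℝ) x = 0 := by simp [hx]
      rw [h1, sub_zero, Real.enorm_of_nonneg ENNReal.toReal_nonneg,
        ENNReal.ofReal_toReal (measure_ne_top _ _)]
      refine measure_mono fun z hz => ?_
      exact Set.mem_uIcc.2 (Or.inr ⟨hz, (not_le.1 hx).le⟩)
  calc ∫⁻ x : ℝ, ‖(μ (Set.Iic x)).toReal - (Set.Ici (0 : ℝ)).indicator 1 x‖ₑ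
      ≤ ∫⁻ x : ℝ, μ {z | x ∈ Set.uIcc 0 z} := lintegral_mono hpt
    _ = (volume.prod μ) {p : ℝ × ℝ | p.1 ∈ Set.uIcc 0 p.2} := (Measure.prod_apply hS).symm
    _ = ∫⁻ z : ℝ, volume (Set.uIcc 0 z) ∂μ := Measure.prod_apply_symm hS
    _ = ∫⁻ z : ℝ, ‖z‖ₑ ∂μ := by
      refine lintegral_congr fun z => ?_
      rw [Real.volume_interval, sub_zero, Real.enorm_eq_ofReal_abs]
    _ < ⊤ := hmom.2

/-- Two nonnegative weight families of the same total mass, applied to a bounded family of reals: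
the difference of the weighted sums is controlled by the product coupling. -/
lemma enorm_tsum_sub_mul_le {T : Type*} (w w' f : T → ℝ) (r : ℝ) (hr : 0 ≤ r)
    (hw0 : ∀ t, 0 ≤ w t) (hw'0 : ∀ t, 0 ≤ w' t) (hw : HasSum w r) (hw' : HasSum w' r)
    (hf : ∀ t, |f t| ≤ 1) :
    ENNReal.ofReal r * ‖∑' t, (w t - w' t) * f t‖ₑ
      ≤ ∑' t, ∑' s, ENNReal.ofReal (w t) * (ENNReal.ofReal (w' s) * ‖f t - f s‖ₑ) := by
  have hs : ∀ v : T → ℝ, (∀ t, 0 ≤ v t) → Summable v → Summable fun t => v t * f t := by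
    intro v hv hvs
    refine Summable.of_norm_bounded hvs fun t => ?_
    rw [norm_mul, Real.norm_of_nonneg (hv t)]
    exact mul_le_of_le_one_right (hv t) (hf t)
  have h1 := (hs w hw0 hw.summable).hasSum
  have h2 := (hs w' hw'0 hw'.summable).hasSum
  have hinner : ∀ t, HasSum (fun s => w' s * (f t - f s)) (r * f t - ∑' s, w' s * f s) := by
    intro t
    simpa only [mul_sub] using (hw'.mul_right (f t)).sub h2
  have houter : HasSum (fun t => w t * (r * f t - ∑' s, w' s * f s))
      (r * ∑' t, (w t - w' t) * f t) := by
    have h3 := (h1.mul_left r).sub (hw.mul_right (∑' s, w' s * f s))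
    have h4 : ∑' t, (w t - w' t) * f t = ∑' t, w t * f t - ∑' t, w' t * f t := by
      simpa only [sub_mul] using (h1.sub h2).tsum_eq
    rw [h4, mul_sub]
    have h5 : (fun t => w t * (r * f t - ∑' s, w' s * f s))
        = fun t => r * (w t * f t) - w t * ∑' s, w' s * f s := by
      funext t
      ring
    rwa [h5]
  calc ENNReal.ofReal r * ‖∑' t, (w t - w' t) * f t‖ₑ
      = ‖∑' t, w t * ∑' s, w' s * (f t - f s)‖ₑ := by
        rw [← Real.enorm_of_nonneg hr, ← enorm_mul, ← houter.tsum_eq]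
        simp only [(hinner _).tsum_eq]
    _ ≤ ∑' t, ‖w t * ∑' s, w' s * (f t - f s)‖ₑ := enorm_tsum_le_tsum_enorm
    _ ≤ _ := by
        refine ENNReal.tsum_le_tsum fun t => ?_
        rw [enorm_mul, Real.enorm_of_nonneg (hw0 t), ENNReal.tsum_mul_left]
        gcongr
        refine enorm_tsum_le_tsum_enorm.trans_eq (tsum_congr fun s => ?_)
        rw [enorm_mul, Real.enorm_of_nonneg (hw'0 s)]

/-- If a countable family of functions is pairwise within `D` in `L¹`, then two nonnegative weight
families of the same total mass `r` give weighted sums within `r * D` in `L¹`. -/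
lemma lintegral_enorm_tsum_sub_mul_le {T α : Type*} [Countable T] [MeasurableSpace α]
    (ν : Measure α) (w w' : T → ℝ) (f : T → α → ℝ) (r : ℝ) (D : ENNReal)
    (hw0 : ∀ t, 0 ≤ w t) (hw'0 : ∀ t, 0 ≤ w' t) (hw : HasSum w r) (hw' : HasSum w' r)
    (hf : ∀ t x, |f t x| ≤ 1) (hfm : ∀ t, Measurable (f t))
    (hD : ∀ t s, ∫⁻ x, ‖f t x - f s x‖ₑ ∂ν ≤ D) :
    ∫⁻ x, ‖∑' t, (w t - w' t) * f t x‖ₑ ∂ν ≤ ENNReal.ofReal r * D := by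
  have hr : 0 ≤ r := hw.nonneg hw0
  rcases hr.eq_or_lt with rfl | hpos
  · have e1 := (hasSum_zero_iff_of_nonneg hw0).1 hw
    have e2 := (hasSum_zero_iff_of_nonneg hw'0).1 hw'
    simp [e1, e2]
  have hsum : ∀ v : T → ℝ, (∀ t, 0 ≤ v t) → HasSum v r →
      ∑' t, ENNReal.ofReal (v t) = ENNReal.ofReal r := fun v hv h => by
    rw [← h.tsum_eq, ENNReal.ofReal_tsum_of_nonneg hv h.summable]
  have hm : ∀ t s, Measurable fun x => ‖f t x - f s x‖ₑ := fun t s =>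
    ((hfm t).sub (hfm s)).enorm
  have key : ENNReal.ofReal r * ∫⁻ x, ‖∑' t, (w t - w' t) * f t x‖ₑ ∂ν
      ≤ ENNReal.ofReal r * (ENNReal.ofReal r * D) := by
    calc ENNReal.ofReal r * ∫⁻ x, ‖∑' t, (w t - w' t) * f t x‖ₑ ∂ν
        = ∫⁻ x, ENNReal.ofReal r * ‖∑' t, (w t - w' t) * f t x‖ₑ ∂ν :=
          (lintegral_const_mul' _ _ ENNReal.ofReal_ne_top).symm
      _ ≤ ∫⁻ x, ∑' t, ∑' s,
            ENNReal.ofReal (w t) * (ENNReal.ofReal (w' s) * ‖f t x - f s x‖ₑ) ∂ν :=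
          lintegral_mono fun x => enorm_tsum_sub_mul_le w w' (f · x) r hr hw0 hw'0 hw hw'
            fun t => hf t x
      _ = ∑' t, ∑' s, ENNReal.ofReal (w t) *
            (ENNReal.ofReal (w' s) * ∫⁻ x, ‖f t x - f s x‖ₑ ∂ν) := by
          rw [lintegral_tsum fun t => (Measurable.tsum fun s =>
            ((hm t s).const_mul _).const_mul _).aemeasurable]
          refine tsum_congr fun t => ?_
          rw [lintegral_tsum fun s => (((hm t s).const_mul _).const_mul _).aemeasurable]
          refine tsum_congr fun s => ?_
          rw [lintegral_const_mul' _ _ ENNReal.ofReal_ne_top,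
            lintegral_const_mul' _ _ ENNReal.ofReal_ne_top]
      _ ≤ ∑' t, ∑' s, ENNReal.ofReal (w t) * (ENNReal.ofReal (w' s) * D) := by
          gcongr with t s
          exact hD t s
      _ = ENNReal.ofReal r * (ENNReal.ofReal r * D) := by
          simp only [ENNReal.tsum_mul_left, ENNReal.tsum_mul_right, hsum w hw0 hw,
            hsum w' hw'0 hw']
  exact (ENNReal.mul_le_mul_iff_right (ENNReal.ofReal_pos.2 hpos).ne' ENNReal.ofReal_ne_top).1 key

/-- The quantitative content of Theorem 5: if the CDFs `F_{ỹ,t̃}` of probability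
measures `μ_{ỹ,t̃}` on `ℝ` are, for each fixed label `ỹ`, pairwise within `D` in
`L¹`, and two nonnegative summable weight families `w`, `w'` have the same
label marginals `ρ(ỹ)` with `Σ_ỹ ρ(ỹ) = 1`, then the `L¹` distance between the
corresponding mixtures of CDFs is at most `D`.
Here `tt` plays the role of `t̃` and `yy` of `ỹ`. -/
theorem mixture_invariant_bound (Y : Type*) [Fintype Y] [Nonempty Y]
    (T : Type*) [Countable T]
    (μ : Y → T → Measure ℝ) [∀ yy tt, IsProbabilityMeasure (μ yy tt)]
    (hmom : ∀ yy tt, Integrable (fun x => x) (μ yy tt))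
    (F : Y → T → ℝ → ℝ) (hF : ∀ yy tt x, F yy tt x = ((μ yy tt) (Set.Iic x)).toReal)
    (D : ℝ) (hD : 0 ≤ D)
    (hDbound : ∀ yy tt tt', ∫ x : ℝ, |F yy tt x - F yy tt' x| ≤ D)
    (w w' : Y → T → ℝ)
    (hw0 : ∀ yy tt, 0 ≤ w yy tt) (hw'0 : ∀ yy tt, 0 ≤ w' yy tt)
    (hwsum : ∀ yy, Summable (w yy)) (hw'sum : ∀ yy, Summable (w' yy))
    (ρ : Y → ℝ)
    (hρ : ∀ yy, ∑' tt : T, w yy tt = ρ yy)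
    (hρ' : ∀ yy, ∑' tt : T, w' yy tt = ρ yy)
    (hρ1 : ∑ yy : Y, ρ yy = 1) :
    ∫ x : ℝ, |∑ yy : Y, ∑' tt : T, (w yy tt - w' yy tt) * F yy tt x| ≤ D := by
  have hF0 : ∀ yy tt x, |F yy tt x| ≤ 1 := fun yy tt x => by
    rw [hF, abs_of_nonneg ENNReal.toReal_nonneg]
    exact measureReal_le_one
  have hFm : ∀ yy tt, Measurable (F yy tt) := fun yy tt => by
    refine Monotone.measurable fun a b hab => ?_
    rw [hF, hF]
    exact ENNReal.toReal_mono (measure_ne_top _ _) (measure_mono (Set.Iic_subset_Iic.2 hab))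
  have hint : ∀ yy tt tt', Integrable fun x => F yy tt x - F yy tt' x := fun yy tt tt' => by
    have h := (integrable_cdf_sub_indicator (μ yy tt) (hmom yy tt)).sub
      (integrable_cdf_sub_indicator (μ yy tt') (hmom yy tt'))
    refine h.congr (Filter.Eventually.of_forall fun x => ?_)
    simp [hF]
  have hlint : ∀ yy tt tt', ∫⁻ x, ‖F yy tt x - F yy tt' x‖ₑ ≤ ENNReal.ofReal D :=
    fun yy tt tt' => by
      rw [← ofReal_integral_norm_eq_lintegral_enorm (hint yy tt tt')]
      exact ENNReal.ofReal_le_ofReal (hDbound yy tt tt')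
  have hws : ∀ yy, HasSum (w yy) (ρ yy) := fun yy => hρ yy ▸ (hwsum yy).hasSum
  have hws' : ∀ yy, HasSum (w' yy) (ρ yy) := fun yy => hρ' yy ▸ (hw'sum yy).hasSum
  have hmeas : ∀ yy, Measurable fun x => ‖∑' tt, (w yy tt - w' yy tt) * F yy tt x‖ₑ :=
    fun yy => (Measurable.tsum fun tt => (hFm yy tt).const_mul _).enorm
  have hmain : ∫⁻ x, ‖∑ yy, ∑' tt, (w yy tt - w' yy tt) * F yy tt x‖ₑ ≤ ENNReal.ofReal D := by
    calc ∫⁻ x, ‖∑ yy, ∑' tt, (w yy tt - w' yy tt) * F yy tt x‖ₑ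
        ≤ ∫⁻ x, ∑ yy, ‖∑' tt, (w yy tt - w' yy tt) * F yy tt x‖ₑ :=
          lintegral_mono fun x => enorm_sum_le _ _
      _ = ∑ yy, ∫⁻ x, ‖∑' tt, (w yy tt - w' yy tt) * F yy tt x‖ₑ :=
          lintegral_finsetSum _ fun yy _ => hmeas yy
      _ ≤ ∑ yy, ENNReal.ofReal (ρ yy) * ENNReal.ofReal D :=
          Finset.sum_le_sum fun yy _ => lintegral_enorm_tsum_sub_mul_le volume (w yy) (w' yy)
            (F yy) (ρ yy) _ (hw0 yy) (hw'0 yy) (hws yy) (hws' yy) (hF0 yy) (hFm yy) (hlint yy)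
      _ = ENNReal.ofReal D := by
          rw [← Finset.sum_mul, ← ENNReal.ofReal_sum_of_nonneg
            fun yy _ => (hws yy).nonneg (hw0 yy), hρ1, ENNReal.ofReal_one, one_mul]
  by_cases hi : Integrable fun x => |∑ yy, ∑' tt, (w yy tt - w' yy tt) * F yy tt x|
  · rw [← ENNReal.ofReal_le_ofReal_iff hD, ofReal_integral_eq_lintegral_ofReal hi
      (Filter.Eventually.of_forall fun x => abs_nonneg _)]
    simpa only [Real.enorm_eq_ofReal_abs] using hmain
  · rw [integral_undef hi]
    exact hD
end

section
/- Let Y be a finite nonempty set, t_max ∈ ℤ, T = {t̃ ∈ ℤ : t̃ ≤ t_max}, and d ∈ ℕ. Let g : ℕ → ℝ be nonnegative, summable, and not identically zero; let f : T → ℝ, β : T → ℝ, and h : T → ℝ be strictly positive, with Σ_{t̃∈T} g(|t̃ − t|)·β(t̃) summable for each t ∈ T; and let S : Y → Mat_{d×d}(ℝ) be any family of matrices. For y ∈ Y and t ∈ T define Σ_MM(y, t) = [Σ_{ỹ∈Y} (Σ_{t̃∈T_single(t)} 4·f(t)·g(|t̃ − t|)·β(t̃) + Σ_{t̃∈T_double(t)}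 f(t)·g(|t̃ − t|)·β(t̃)) · S(ỹ)] / [(Σ_{ỹ∈Y} Σ_{t̃∈T} w_t(t̃)·f(t)·g(|t̃ − t|))² · h(t)]. Then there exists a function c : T → ℝ with c(t) > 0 for all t such that Σ_MM(y, t) = c(t) · Σ_MM(y, t_max) for every y ∈ Y and every t ∈ T. -/
open scoped BigOperators

/-- The covariance matrix of the PMP-aggregated message at label `y` and time
`t` (for a decay function `g` independent of labels, as in Assumption 4):
numerator summed over labels `yy` with weight `4` on `T_single(t)` and `1` on
`T_double(t)` (times the scale `f(t)` and the previous-layer factors `β(t̃)`),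
denominator the squared PMP normalization times `h(t)`. -/
noncomputable def SigmaMM {Y : Type*} [Fintype Y] (tmax : ℤ) (d : ℕ)
    (g : ℕ → ℝ) (f β h : {s : ℤ // s ≤ tmax} → ℝ)
    (S : Y → Matrix (Fin d) (Fin d) ℝ)
    (y : Y) (t : {s : ℤ // s ≤ tmax}) : Matrix (Fin d) (Fin d) ℝ :=
  ((∑ yy : Y, ∑' tt : {s : ℤ // s ≤ tmax},
      (if tt = t ∨ tmax - (t : ℤ) < |(tt : ℤ) - (t : ℤ)| then (2 : ℝ) else 1) *
        f t * g ((tt : ℤ) - (t : ℤ)).natAbs) ^ 2 * h t)⁻¹ •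
  (∑ yy : Y,
    ((∑' tt : {tt : {s : ℤ // s ≤ tmax} //
          tt = t ∨ tmax - (t : ℤ) < |(tt : ℤ) - (t : ℤ)|},
        4 * f t * g ((tt.1 : ℤ) - (t : ℤ)).natAbs * β tt.1) +
     (∑' tt : {tt : {s : ℤ // s ≤ tmax} //
          0 < |(tt : ℤ) - (t : ℤ)| ∧ |(tt : ℤ) - (t : ℤ)| ≤ tmax - (t : ℤ)},
        f t * g ((tt.1 : ℤ) - (t : ℤ)).natAbs * β tt.1)) • S yy)

theorem summable_natAbs_sub {g : ℕ → ℝ} (hg : Summable g) (tmax a : ℤ) :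
    Summable (fun s : {s : ℤ // s ≤ tmax} => g ((s : ℤ) - a).natAbs) := by
  have hZ : Summable (fun n : ℤ => g n.natAbs) :=
    Summable.of_nat_of_neg (by simpa using hg) (by simpa using hg)
  have hinj : Function.Injective (fun s : {s : ℤ // s ≤ tmax} => (s : ℤ) - a) :=
    fun x y hxy => Subtype.ext (sub_left_injective hxy)
  exact hZ.comp_injective hinj

/-- The squared normalization times `h t` in the denominator of `SigmaMM`. -/
noncomputable def messageDenominator (Y : Type*) [Fintype Y] (tmax : ℤ) (g : ℕ → ℝ)
    (f h : {s : ℤ // s ≤ tmax} → ℝ) (t : {s : ℤ // s ≤ tmax}) : ℝ :=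
  (∑ _yy : Y, ∑' tt : {s : ℤ // s ≤ tmax},
      (if tt = t ∨ tmax - (t : ℤ) < |(tt : ℤ) - (t : ℤ)| then (2 : ℝ) else 1) *
        f t * g ((tt : ℤ) - (t : ℤ)).natAbs) ^ 2 * h t

/-- The scalar multiplying each `S yy` in the numerator of `SigmaMM`. -/
noncomputable def messageNumerator (tmax : ℤ) (g : ℕ → ℝ)
    (f β : {s : ℤ // s ≤ tmax} → ℝ) (t : {s : ℤ // s ≤ tmax}) : ℝ :=
  (∑' tt : {tt : {s : ℤ // s ≤ tmax} //
        tt = t ∨ tmax - (t : ℤ) < |(tt : ℤ) - (t : ℤ)|},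
      4 * f t * g ((tt.1 : ℤ) - (t : ℤ)).natAbs * β tt.1) +
  (∑' tt : {tt : {s : ℤ // s ≤ tmax} //
        0 < |(tt : ℤ) - (t : ℤ)| ∧ |(tt : ℤ) - (t : ℤ)| ≤ tmax - (t : ℤ)},
      f t * g ((tt.1 : ℤ) - (t : ℤ)).natAbs * β tt.1)

theorem SigmaMM_eq_smul_sum {Y : Type*} [Fintype Y] (tmax : ℤ) (d : ℕ)
    (g : ℕ → ℝ) (f β h : {s : ℤ // s ≤ tmax} → ℝ)
    (S : Y → Matrix (Fin d) (Fin d) ℝ) (y : Y) (t : {s : ℤ // s ≤ tmax}) :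
    SigmaMM tmax d g f β h S y t =
      ((messageDenominator Y tmax g f h t)⁻¹ * messageNumerator tmax g f β t) •
        ∑ yy, S yy := by
  rw [mul_smul, Finset.smul_sum]
  rfl

theorem exists_pos_natAbs_sub {g : ℕ → ℝ} (hg0 : ∀ n, 0 ≤ g n) (hgne : ∃ n, g n ≠ 0)
    {tmax : ℤ} (t : {s : ℤ // s ≤ tmax}) :
    ∃ s : {s : ℤ // s ≤ tmax}, 0 < g ((s : ℤ) - (t : ℤ)).natAbs := by
  obtain ⟨n, hn⟩ := hgne
  have ht := t.2
  refine ⟨⟨t - n, by omega⟩, ?_⟩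
  have habs : ((t : ℤ) - n - t).natAbs = n := by omega
  rw [habs]
  exact (hg0 n).lt_of_ne' hn

theorem messageDenominator_pos (Y : Type*) [Fintype Y] [Nonempty Y] {tmax : ℤ}
    {g : ℕ → ℝ} (hg0 : ∀ n, 0 ≤ g n) (hgsum : Summable g) (hgne : ∃ n, g n ≠ 0)
    {f h : {s : ℤ // s ≤ tmax} → ℝ} (hf : ∀ t, 0 < f t) (hh : ∀ t, 0 < h t)
    (t : {s : ℤ // s ≤ tmax}) : 0 < messageDenominator Y tmax g f h t := by
  obtain ⟨s, hs⟩ := exists_pos_natAbs_sub hg0 hgne t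
  refine mul_pos (pow_pos (Finset.sum_pos (fun _ _ => ?_) Finset.univ_nonempty) 2) (hh t)
  have hft := hf t
  have hnonneg (tt : {s : ℤ // s ≤ tmax}) :
      0 ≤ f t * g ((tt : ℤ) - (t : ℤ)).natAbs := mul_nonneg hft.le (hg0 _)
  refine Summable.tsum_pos (i := s) ?_ (fun tt => ?_) ?_
  · refine Summable.of_nonneg_of_le (fun tt => ?_) (fun tt => ?_)
      ((summable_natAbs_sub hgsum tmax t).mul_left (2 * f t))
    all_goals have := hnonneg tt; split_ifs <;> linarith
  · have := hnonneg tt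
    split_ifs <;> linarith
  · have := mul_pos hft hs
    split_ifs <;> linarith

theorem messageNumerator_pos {tmax : ℤ} {g : ℕ → ℝ} (hg0 : ∀ n, 0 ≤ g n)
    (hgne : ∃ n, g n ≠ 0) {f β : {s : ℤ // s ≤ tmax} → ℝ}
    (hf : ∀ t, 0 < f t) (hβ : ∀ t, 0 < β t) (t : {s : ℤ // s ≤ tmax})
    (hgβsum : Summable (fun tt : {s : ℤ // s ≤ tmax} =>
      g ((tt : ℤ) - (t : ℤ)).natAbs * β tt)) :
    0 < messageNumerator tmax g f β t := by
  obtain ⟨s, hs⟩ := exists_pos_natAbs_sub hg0 hgne t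
  have hft := hf t
  have hnonneg (a : ℝ) (ha : 0 < a) (tt : {s : ℤ // s ≤ tmax}) :
      0 ≤ a * g ((tt : ℤ) - (t : ℤ)).natAbs * β tt :=
    mul_nonneg (mul_nonneg ha.le (hg0 _)) (hβ tt).le
  have hsum (a : ℝ) (p : {s : ℤ // s ≤ tmax} → Prop) :
      Summable (fun tt : {tt // p tt} =>
        a * g ((tt.1 : ℤ) - (t : ℤ)).natAbs * β tt.1) := by
    simpa only [mul_assoc, Function.comp_def] using
      (hgβsum.mul_left a).comp_injective (Subtype.val_injective (p := p))
  have hpos (a : ℝ) (ha : 0 < a) (p : {s : ℤ // s ≤ tmax} → Prop) (hps : p s) :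
      0 < ∑' tt : {tt // p tt}, a * g ((tt.1 : ℤ) - (t : ℤ)).natAbs * β tt.1 :=
    (hsum a p).tsum_pos (fun tt => hnonneg a ha tt.1) ⟨s, hps⟩
      (mul_pos (mul_pos ha hs) (hβ s))
  have h4 : 0 < 4 * f t := by positivity
  by_cases hst : s = t ∨ tmax - (t : ℤ) < |(s : ℤ) - (t : ℤ)|
  · exact add_pos_of_pos_of_nonneg (hpos _ h4 _ hst)
      (tsum_nonneg fun tt => hnonneg _ hft tt.1)
  · rw [not_or, not_lt] at hst
    exact add_pos_of_nonneg_of_pos (tsum_nonneg fun tt => hnonneg _ h4 tt.1)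
      (hpos _ hft _ ⟨abs_pos.2 (sub_ne_zero.2 (Subtype.coe_injective.ne hst.1)), hst.2⟩)

/-- Lemma 1 (JJnorm lemma): under Assumption 4, the covariance matrices of the
PMP-aggregated message at times `t` and `t_max` differ only by a positive
scalar factor `c(t)` depending on `t` alone (not on the label `y`). -/
theorem jjnorm_lemma (Y : Type*) [Fintype Y] [Nonempty Y] (tmax : ℤ) (d : ℕ)
    (g : ℕ → ℝ) (hg0 : ∀ n, 0 ≤ g n) (hgsum : Summable g)
    (hgne : ∃ n, g n ≠ 0)
    (f β h : {s : ℤ // s ≤ tmax} → ℝ)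
    (hf : ∀ t, 0 < f t) (hβ : ∀ t, 0 < β t) (hh : ∀ t, 0 < h t)
    (hgβsum : ∀ t : {s : ℤ // s ≤ tmax},
      Summable (fun tt : {s : ℤ // s ≤ tmax} =>
        g ((tt : ℤ) - (t : ℤ)).natAbs * β tt))
    (S : Y → Matrix (Fin d) (Fin d) ℝ) :
    ∃ c : {s : ℤ // s ≤ tmax} → ℝ, (∀ t, 0 < c t) ∧
      ∀ (y : Y) (t : {s : ℤ // s ≤ tmax}),
        SigmaMM tmax d g f β h S y t =
          c t • SigmaMM tmax d g f β h S y ⟨tmax, le_refl tmax⟩ := by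
  have hpos (t : {s : ℤ // s ≤ tmax}) :
      0 < (messageDenominator Y tmax g f h t)⁻¹ * messageNumerator tmax g f β t :=
    mul_pos (inv_pos.2 (messageDenominator_pos Y hg0 hgsum hgne hf hh t))
      (messageNumerator_pos hg0 hgne hf hβ t (hgβsum t))
  refine ⟨fun t => _ / _, fun t => div_pos (hpos t) (hpos ⟨tmax, le_refl tmax⟩),
    fun y t => ?_⟩
  rw [SigmaMM_eq_smul_sum, SigmaMM_eq_smul_sum, smul_smul,
    div_mul_cancel₀ _ (hpos ⟨tmax, le_refl tmax⟩).ne']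
end
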